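/- Let ω₁, ω₂, N > 0 and let C be the topological space (ℝ/ω₁ℤ) × (ℝ/ω₂ℤ) × [−N,N]. Define the two commuting involutions σ₁(θ₁,θ₂,θ₃) = (−θ₁, ω₂/2−θ₂, θ₃) and σ₂(θ₁,θ₂,θ₃) = (θ₁, −θ₂, −θ₃) of C, and let ∼ be the equivalence relation on C whose classes are the orbits of the group generated by σ₁ and σ₂ (i.e. p ∼ q iff q ∈ {p, σ₁p, σ₂p, σ₁σ₂p}). Then the quotient space C/∼, with the quotient topology, is homeomorphic to the closed unit ball {x ∈ ℝ³ : |x| ≤ 1}. -/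

import Mathlib

open Set

/-- The cylinder `C = (ℝ/ω₁ℤ) × (ℝ/ω₂ℤ) × [-N,N]`. -/
abbrev Cyl (ω₁ ω₂ N : ℝ) := AddCircle ω₁ × AddCircle ω₂ × Icc (-N) N

/-- The involution `σ₁(θ₁,θ₂,θ₃) = (−θ₁, ω₂/2−θ₂, θ₃)`. -/
noncomputable def sigma1 (ω₁ ω₂ N : ℝ) (p : Cyl ω₁ ω₂ N) : Cyl ω₁ ω₂ N :=
  (-p.1, ((ω₂ / 2 : ℝ) : AddCircle ω₂) - p.2.1, p.2.2)

/-- The involution `σ₂(θ₁,θ₂,θ₃) = (θ₁, −θ₂, −θ₃)`. -/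
noncomputable def sigma2 (ω₁ ω₂ N : ℝ) (p : Cyl ω₁ ω₂ N) : Cyl ω₁ ω₂ N :=
  (p.1, -p.2.1, ⟨-(p.2.2 : ℝ), by
    have h := p.2.2.2
    simp only [mem_Icc] at h ⊢
    constructor <;> linarith [h.1, h.2]⟩)

/-- The orbit equivalence relation of the group generated by `σ₁` and `σ₂`:
`p ∼ q` iff `q ∈ {p, σ₁ p, σ₂ p, σ₁ (σ₂ p)}`. -/
def orbitRel (ω₁ ω₂ N : ℝ) (p q : Cyl ω₁ ω₂ N) : Prop :=
  q = p ∨ q = sigma1 ω₁ ω₂ N p ∨ q = sigma2 ω₁ ω₂ N p ∨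
    q = sigma1 ω₁ ω₂ N (sigma2 ω₁ ω₂ N p)


/-- Two-sided sign splitting: `a ^ 2 * b ^ 2 = y ^ 2` realised with signs. -/
lemma aux_sqrt_sign (P Q y : ℝ) (hP : 0 ≤ P) (hQ : 0 ≤ Q) (h : y ^ 2 = P * Q) :
    ∃ s C : ℝ, 0 ≤ s ∧ s ^ 2 = P ∧ C ^ 2 = Q ∧ s * C = y := by
  rcases le_total 0 y with hy | hy
  · refine ⟨√P, √Q, Real.sqrt_nonneg _, Real.sq_sqrt hP, Real.sq_sqrt hQ, ?_⟩
    rw [← Real.sqrt_mul hP, ← h, Real.sqrt_sq hy]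
  · refine ⟨√P, -√Q, Real.sqrt_nonneg _, Real.sq_sqrt hP, by rw [neg_sq, Real.sq_sqrt hQ], ?_⟩
    rw [mul_neg, ← Real.sqrt_mul hP, ← h, Real.sqrt_sq_eq_abs, abs_of_nonpos hy, neg_neg]

lemma aux_K_unique (m K K' : ℝ) (h : K = 1 + K ^ 2 * m) (h' : K' = 1 + K' ^ 2 * m)
    (hK : 1 ≤ K) (hK2 : K ≤ 2) (hK' : 1 ≤ K') (hK2' : K' ≤ 2) : K = K' := by
  by_contra hne
  have h1 : (K - K') * (1 - (K + K') * m) = 0 := by linear_combination h - h'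
  have h2 : (K + K') * m = 1 := by
    rcases mul_eq_zero.1 h1 with h3 | h3
    · exact absurd (sub_eq_zero.1 h3) hne
    · linarith
  have h3 : K * K' * m = 1 := by
    linear_combination K * h2 + h
  have h4 : K + K' = K * K' := by linear_combination (K * K') * h2 - (K + K') * h3
  have h5 : (2 - K) * (K' - 1) ≥ 0 := mul_nonneg (by linarith) (by linarith)
  have h6 : (2 - K') * (K - 1) ≥ 0 := mul_nonneg (by linarith) (by linarith)
  exact hne (by nlinarith)

/-- squaring on the plane is injective up to sign -/
lemma aux_sq_inj (z t z' t' : ℝ) (h1 : z * t = z' * t')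
    (h2 : z ^ 2 - t ^ 2 = z' ^ 2 - t' ^ 2) : (z = z' ∧ t = t') ∨ (z = -z' ∧ t = -t') := by
  have h3 : z ^ 2 + t ^ 2 = z' ^ 2 + t' ^ 2 := by
    have : (z ^ 2 + t ^ 2) ^ 2 = (z' ^ 2 + t' ^ 2) ^ 2 := by
      linear_combination (z ^ 2 - t ^ 2 + z' ^ 2 - t' ^ 2) * h2 + 4 * (z * t + z' * t') * h1
    exact (pow_left_inj₀ (by positivity) (by positivity) two_ne_zero).1 this
  have hz : z ^ 2 = z' ^ 2 := by linarith
  have ht : t ^ 2 = t' ^ 2 := by linarith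
  rcases sq_eq_sq_iff_eq_or_eq_neg.1 hz with rfl | rfl
  · rcases sq_eq_sq_iff_eq_or_eq_neg.1 ht with rfl | rfl
    · simp
    · have : z = 0 ∨ t' = 0 := mul_eq_zero.1 (by linarith)
      rcases this with rfl | rfl <;> simp
  · rcases sq_eq_sq_iff_eq_or_eq_neg.1 ht with rfl | rfl
    · have : z' = 0 ∨ t = 0 := mul_eq_zero.1 (by linarith)
      rcases this with rfl | rfl <;> simp
    · simp

/-- The three coordinates. -/
noncomputable def fK (c S : ℝ) : ℝ := √(1 + c ^ 2 * S ^ 2)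
noncomputable def fG (t : ℝ) : ℝ := √((1 + t ^ 2) / 2)

lemma fK_sq (c S : ℝ) : fK c S ^ 2 = 1 + c ^ 2 * S ^ 2 := Real.sq_sqrt (by positivity)
lemma fK_pos (c S : ℝ) : 0 < fK c S := Real.sqrt_pos.2 (by positivity)
lemma fG_sq (t : ℝ) : fG t ^ 2 = (1 + t ^ 2) / 2 := Real.sq_sqrt (by positivity)
lemma fG_pos (t : ℝ) : 0 < fG t := Real.sqrt_pos.2 (by positivity)

lemma aux_sphere (c s C S : ℝ) (h : c ^ 2 + s ^ 2 = 1) (h' : C ^ 2 + S ^ 2 = 1) :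
    (c / fK c S) ^ 2 + (s * C / fK c S) ^ 2 + (S / fK c S) ^ 2 = 1 := by
  have := fK_pos c S
  rw [div_pow, div_pow, div_pow, ← add_div, ← add_div, div_eq_one_iff_eq (by positivity), fK_sq]
  have e1 : s ^ 2 = 1 - c ^ 2 := by linarith
  have e2 : C ^ 2 = 1 - S ^ 2 := by linarith
  rw [mul_pow, e1, e2]; ring

lemma core_norm (u v z t : ℝ) (h : u ^ 2 + v ^ 2 + z ^ 2 = 1) (ht : t ^ 2 ≤ 1) :
    (u * fG t) ^ 2 + (v * fG t) ^ 2 + (z * t) ^ 2 ≤ 1 := by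
  have e : (u * fG t) ^ 2 + (v * fG t) ^ 2 + (z * t) ^ 2
      = (1 - z ^ 2) * ((1 + t ^ 2) / 2) + z ^ 2 * t ^ 2 := by
    rw [← fG_sq]; linear_combination (fG t ^ 2) * h
  rw [e]
  nlinarith [mul_nonneg (by positivity : 0 ≤ 1 + z ^ 2) (sub_nonneg.2 ht)]

lemma core_inj1 (u v z t u' v' z' t' : ℝ) (h : u ^ 2 + v ^ 2 + z ^ 2 = 1)
    (h' : u' ^ 2 + v' ^ 2 + z' ^ 2 = 1)
    (e1 : u * fG t = u' * fG t') (e2 : v * fG t = v' * fG t') (e3 : z * t = z' * t') :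
    u = u' ∧ v = v' ∧ ((z = z' ∧ t = t') ∨ (z = -z' ∧ t = -t')) := by
  have q : z ^ 2 - t ^ 2 = z' ^ 2 - t' ^ 2 := by
    have a1 : (u * fG t) ^ 2 + (v * fG t) ^ 2 = (1 - z ^ 2) * ((1 + t ^ 2) / 2) := by
      rw [← fG_sq]; linear_combination (fG t ^ 2) * h
    have a2 : (u' * fG t') ^ 2 + (v' * fG t') ^ 2 = (1 - z' ^ 2) * ((1 + t' ^ 2) / 2) := by
      rw [← fG_sq]; linear_combination (fG t' ^ 2) * h'
    rw [e1, e2] at a1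
    linear_combination 2 * a1 - 2 * a2 - (z * t + z' * t') * e3
  have r := aux_sq_inj z t z' t' e3 q
  have hG : fG t = fG t' := by
    rcases r with ⟨-, rfl⟩ | ⟨-, rfl⟩
    · rfl
    · simp [fG]
  rw [hG] at e1 e2
  have := (fG_pos t').ne'
  exact ⟨mul_right_cancel₀ this e1, mul_right_cancel₀ this e2, r⟩

lemma core_inj2 (c s C S c' s' C' S' : ℝ) (h1 : c ^ 2 + s ^ 2 = 1) (h2 : C ^ 2 + S ^ 2 = 1)
    (h1' : c' ^ 2 + s' ^ 2 = 1) (h2' : C' ^ 2 + S' ^ 2 = 1)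
    (e1 : c / fK c S = c' / fK c' S') (e3 : (S / fK c S) ^ 2 = (S' / fK c' S') ^ 2) :
    fK c S = fK c' S' := by
  have key : ∀ c s C S : ℝ, c ^ 2 + s ^ 2 = 1 → C ^ 2 + S ^ 2 = 1 →
      fK c S ^ 2 = 1 + (fK c S ^ 2) ^ 2 * ((c / fK c S) ^ 2 * (S / fK c S) ^ 2) ∧
      1 ≤ fK c S ^ 2 ∧ fK c S ^ 2 ≤ 2 := by
    intro c s C S h1 h2
    have hp := (fK_pos c S).ne'
    refine ⟨?_, ?_, ?_⟩
    · have : (fK c S ^ 2) ^ 2 * ((c / fK c S) ^ 2 * (S / fK c S) ^ 2) = c ^ 2 * S ^ 2 := by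
        field_simp
      rw [this, fK_sq]
    · rw [fK_sq]; nlinarith [mul_nonneg (sq_nonneg c) (sq_nonneg S)]
    · rw [fK_sq]
      have : c ^ 2 * S ^ 2 ≤ 1 * 1 :=
        mul_le_mul (by nlinarith) (by nlinarith) (sq_nonneg _) zero_le_one
      linarith
  obtain ⟨a, b, d⟩ := key c s C S h1 h2
  obtain ⟨a', b', d'⟩ := key c' s' C' S' h1' h2'
  rw [e1, e3] at a
  have := aux_K_unique _ _ _ a a' b d b' d'
  exact (pow_left_inj₀ (fK_pos _ _).le (fK_pos _ _).le two_ne_zero).1 this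

lemma core_inj (c s C S t c' s' C' S' t' : ℝ) (h1 : c ^ 2 + s ^ 2 = 1) (h2 : C ^ 2 + S ^ 2 = 1)
    (h1' : c' ^ 2 + s' ^ 2 = 1) (h2' : C' ^ 2 + S' ^ 2 = 1)
    (e1 : c / fK c S * fG t = c' / fK c' S' * fG t')
    (e2 : s * C / fK c S * fG t = s' * C' / fK c' S' * fG t')
    (e3 : S / fK c S * t = S' / fK c' S' * t') :
    c = c' ∧ s * C = s' * C' ∧ ((S = S' ∧ t = t') ∨ (S = -S' ∧ t = -t')) := by
  obtain ⟨a, b, d⟩ := core_inj1 _ _ _ _ _ _ _ _ (aux_sphere c s C S h1 h2)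
    (aux_sphere c' s' C' S' h1' h2') e1 e2 e3
  have hk := core_inj2 c s C S c' s' C' S' h1 h2 h1' h2' a (by
    rcases d with ⟨d, -⟩ | ⟨d, -⟩ <;> rw [d]
    rw [neg_sq])
  have hp := (fK_pos c' S').ne'
  rw [hk] at a b d
  refine ⟨(div_left_inj' hp).1 a, (div_left_inj' hp).1 b, ?_⟩
  rw [← neg_div, div_left_inj' hp, div_left_inj' hp] at d
  exact d

lemma core_surj1 (p q r : ℝ) (h : p ^ 2 + q ^ 2 + r ^ 2 ≤ 1) :
    ∃ u v z t : ℝ, u ^ 2 + v ^ 2 + z ^ 2 = 1 ∧ t ^ 2 ≤ 1 ∧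
      u * fG t = p ∧ v * fG t = q ∧ z * t = r := by
  set A := 2 * (p ^ 2 + q ^ 2) + r ^ 2 - 1 with hA
  set R := √(A ^ 2 + 4 * r ^ 2) with hR
  have hR2 : R ^ 2 = A ^ 2 + 4 * r ^ 2 := Real.sq_sqrt (by positivity)
  have hR0 : 0 ≤ R := Real.sqrt_nonneg _
  have hAR : |A| ≤ R := Real.abs_le_sqrt (by nlinarith)
  have hAR' := abs_le.1 hAR
  obtain ⟨z, t, hz0, hz, ht, hzt⟩ := aux_sqrt_sign ((R - A) / 2) ((R + A) / 2) r
    (by linarith) (by linarith) (by linear_combination (-1 / 4) * hR2)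
  have hg := fG_pos t
  refine ⟨p / fG t, q / fG t, z, t, ?_, ?_, by field_simp, by field_simp, hzt⟩
  · rw [div_pow, div_pow, ← add_div, fG_sq]
    have : (p ^ 2 + q ^ 2) / ((1 + t ^ 2) / 2) = 1 - z ^ 2 := by
      rw [div_eq_iff (by positivity)]
      have : z ^ 2 * t ^ 2 = r ^ 2 := by rw [← hzt]; ring
      linear_combination (1 / 2) * hA - (1 / 2) * ht + (1 / 2) * hz + (1 / 2) * this
    linarith
  · have : R ≤ 2 - A := abs_le_of_sq_le_sq' (by nlinarith) (by nlinarith) |>.2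
    linarith

lemma core_surj2 (u v z : ℝ) (h : u ^ 2 + v ^ 2 + z ^ 2 = 1) :
    ∃ c s C S : ℝ, c ^ 2 + s ^ 2 = 1 ∧ C ^ 2 + S ^ 2 = 1 ∧
      c / fK c S = u ∧ s * C / fK c S = v ∧ S / fK c S = z := by
  set D := √(1 - 4 * u ^ 2 * z ^ 2) with hD
  have hD0 : 0 ≤ D := Real.sqrt_nonneg _
  have hD2 : D ^ 2 = 1 - 4 * u ^ 2 * z ^ 2 :=
    Real.sq_sqrt (by nlinarith [sq_nonneg (u ^ 2 - z ^ 2), sq_nonneg u, sq_nonneg z, sq_nonneg v])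
  obtain ⟨K, hK⟩ : ∃ K, K = 2 / (1 + D) := ⟨_, rfl⟩
  have hKpos : 0 < K := by rw [hK]; positivity
  have hKD : K * (1 + D) = 2 := by rw [hK]; field_simp
  have hKeq : K = 1 + K ^ 2 * (u ^ 2 * z ^ 2) := by
    linear_combination (-1 / 4) * (K ^ 2) * hD2 + (1 / 2 + K * (D - 1) / 4) * hKD
  have hu : K * u ^ 2 ≤ 1 := by
    have : 2 * u ^ 2 - 1 ≤ D := Real.le_sqrt_of_sq_le (by nlinarith [mul_nonneg (sq_nonneg u) (sq_nonneg v)])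
    nlinarith
  have hz : K * z ^ 2 ≤ 1 := by
    have : 2 * z ^ 2 - 1 ≤ D := Real.le_sqrt_of_sq_le (by nlinarith [mul_nonneg (sq_nonneg z) (sq_nonneg v)])
    nlinarith
  obtain ⟨k, hk0, hk⟩ : ∃ k : ℝ, 0 < k ∧ k ^ 2 = K :=
    ⟨√K, Real.sqrt_pos.2 hKpos, Real.sq_sqrt hKpos.le⟩
  obtain ⟨s, C, -, hs, hC, hsC⟩ := aux_sqrt_sign (1 - K * u ^ 2) (1 - K * z ^ 2) (k * v)
    (by linarith) (by linarith) (by rw [mul_pow, hk]; linear_combination hKeq + K * h)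
  have hf : fK (k * u) (k * z) = k := by
    rw [fK, show 1 + (k * u) ^ 2 * (k * z) ^ 2 = k ^ 2 by
      rw [mul_pow, mul_pow, hk]; linear_combination -hKeq, Real.sqrt_sq hk0.le]
  refine ⟨k * u, s, C, k * z, ?_, ?_, ?_, ?_, ?_⟩
  · rw [mul_pow, hk, hs]; ring
  · rw [mul_pow, hk, hC]; ring
  · rw [hf]; field_simp
  · rw [hf, hsC]; field_simp
  · rw [hf]; field_simp

/-- cosine and sine on the additive circle -/
noncomputable def cC {T : ℝ} (x : AddCircle T) : ℝ := (AddCircle.toCircle x : ℂ).re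
noncomputable def cS {T : ℝ} (x : AddCircle T) : ℝ := (AddCircle.toCircle x : ℂ).im

section
variable {T : ℝ}

lemma cCS (x : AddCircle T) : cC x ^ 2 + cS x ^ 2 = 1 := by
  have := Circle.normSq_coe (AddCircle.toCircle x)
  rw [Complex.normSq_apply] at this
  simp only [cC, cS]; linarith

lemma cC_neg (x : AddCircle T) : cC (-x) = cC x := by
  simp [cC, AddCircle.toCircle_neg]
lemma cS_neg (x : AddCircle T) : cS (-x) = -cS x := by
  simp [cS, AddCircle.toCircle_neg]

lemma toCircle_half (hT : T ≠ 0) :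
    ((AddCircle.toCircle ((T / 2 : ℝ) : AddCircle T) : Circle) : ℂ) = -1 := by
  rw [AddCircle.toCircle_apply_mk, show 2 * Real.pi / T * (T / 2) = Real.pi by field_simp]
  simp [Circle.coe_exp]

lemma cC_half (hT : T ≠ 0) (x : AddCircle T) : cC (((T / 2 : ℝ) : AddCircle T) - x) = -cC x := by
  simp [cC, sub_eq_add_neg, AddCircle.toCircle_add, AddCircle.toCircle_neg, toCircle_half hT]
lemma cS_half (hT : T ≠ 0) (x : AddCircle T) : cS (((T / 2 : ℝ) : AddCircle T) - x) = cS x := by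
  simp [cS, sub_eq_add_neg, AddCircle.toCircle_add, AddCircle.toCircle_neg, toCircle_half hT]

lemma cCS_ext (hT : T ≠ 0) {x y : AddCircle T} (h : cC x = cC y) (h' : cS x = cS y) : x = y :=
  AddCircle.injective_toCircle hT (Circle.ext (Complex.ext h h'))

lemma cCS_surj (hT : T ≠ 0) (c s : ℝ) (h : c ^ 2 + s ^ 2 = 1) :
    ∃ x : AddCircle T, cC x = c ∧ cS x = s := by
  obtain ⟨x, hx⟩ := (AddCircle.homeomorphCircle hT).surjective
    ⟨⟨c, s⟩, by
      have h2 : ‖(⟨c, s⟩ : ℂ)‖ = 1 := by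
        rw [Complex.norm_def, Complex.normSq_apply, Real.sqrt_eq_one]; simp only; linarith
      exact mem_sphere_zero_iff_norm.2 h2⟩
  rw [AddCircle.homeomorphCircle_apply] at hx
  exact ⟨x, by simp [cC, hx], by simp [cS, hx]⟩

lemma continuous_cC : Continuous (cC : AddCircle T → ℝ) :=
  Complex.continuous_re.comp (continuous_subtype_val.comp AddCircle.continuous_toCircle)
lemma continuous_cS : Continuous (cS : AddCircle T → ℝ) :=
  Complex.continuous_im.comp (continuous_subtype_val.comp AddCircle.continuous_toCircle)
end

/-- The invariant map to `ℝ³`. -/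
noncomputable def bmap (ω₁ ω₂ N : ℝ) (p : Cyl ω₁ ω₂ N) : EuclideanSpace ℝ (Fin 3) :=
  !₂[cC p.1 / fK (cC p.1) (cS p.2.1) * fG (p.2.2 / N),
    cS p.1 * cC p.2.1 / fK (cC p.1) (cS p.2.1) * fG (p.2.2 / N),
    cS p.2.1 / fK (cC p.1) (cS p.2.1) * (p.2.2 / N)]

lemma bmap_continuous (ω₁ ω₂ N : ℝ) : Continuous (bmap ω₁ ω₂ N) := by
  have h1 : Continuous fun p : Cyl ω₁ ω₂ N => cC p.1 := continuous_cC.comp continuous_fst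
  have h2 : Continuous fun p : Cyl ω₁ ω₂ N => cS p.1 := continuous_cS.comp continuous_fst
  have h3 : Continuous fun p : Cyl ω₁ ω₂ N => cC p.2.1 := continuous_cC.comp (by fun_prop)
  have h4 : Continuous fun p : Cyl ω₁ ω₂ N => cS p.2.1 := continuous_cS.comp (by fun_prop)
  have h5 : Continuous fun p : Cyl ω₁ ω₂ N => (p.2.2 : ℝ) / N := by fun_prop
  have h6 : Continuous fun p : Cyl ω₁ ω₂ N => fG ((p.2.2 : ℝ) / N) := by
    unfold fG; fun_prop
  have h7 : Continuous fun p : Cyl ω₁ ω₂ N => fK (cC p.1) (cS p.2.1) := by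
    unfold fK; fun_prop
  have h8 : ∀ p : Cyl ω₁ ω₂ N, fK (cC p.1) (cS p.2.1) ≠ 0 := fun p => (fK_pos _ _).ne'
  unfold bmap
  refine (PiLp.continuous_toLp 2 _).comp (continuous_pi fun i => ?_)
  fin_cases i
  · exact (h1.div h7 h8).mul h6
  · exact ((h2.mul h3).div h7 h8).mul h6
  · exact (h4.div h7 h8).mul h5

lemma mem_ball_iff (x : EuclideanSpace ℝ (Fin 3)) :
    x ∈ Metric.closedBall (0 : EuclideanSpace ℝ (Fin 3)) 1 ↔
      x 0 ^ 2 + x 1 ^ 2 + x 2 ^ 2 ≤ 1 := by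
  rw [mem_closedBall_zero_iff, ← sq_le_one_iff₀ (norm_nonneg x), EuclideanSpace.norm_sq_eq,
    Fin.sum_univ_three]
  simp

lemma bmap_mem (ω₁ ω₂ N : ℝ) (hN : 0 < N) (p : Cyl ω₁ ω₂ N) :
    bmap ω₁ ω₂ N p ∈ Metric.closedBall (0 : EuclideanSpace ℝ (Fin 3)) 1 := by
  rw [mem_ball_iff]
  have h := p.2.2.2
  refine core_norm _ _ _ _ (aux_sphere _ _ _ _ (cCS p.1) (cCS p.2.1)) ?_
  rw [div_pow, div_le_one (by positivity)]
  exact sq_le_sq' h.1 h.2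

lemma bmap_rel (ω₁ ω₂ N : ℝ) (hω₂ : 0 < ω₂) (p q : Cyl ω₁ ω₂ N)
    (h : orbitRel ω₁ ω₂ N p q) : bmap ω₁ ω₂ N p = bmap ω₁ ω₂ N q := by
  have s1 : ∀ p, bmap ω₁ ω₂ N (sigma1 ω₁ ω₂ N p) = bmap ω₁ ω₂ N p := by
    intro p
    simp [bmap, sigma1, cC_half hω₂.ne', cS_half hω₂.ne', cC_neg, cS_neg]
  have s2 : ∀ p, bmap ω₁ ω₂ N (sigma2 ω₁ ω₂ N p) = bmap ω₁ ω₂ N p := by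
    intro p
    simp [bmap, sigma2, cC_neg, cS_neg, fK, fG, neg_div]
  rcases h with rfl | rfl | rfl | rfl
  · rfl
  · rw [s1]
  · rw [s2]
  · rw [s1, s2]

lemma bmap_inj (ω₁ ω₂ N : ℝ) (hω₁ : 0 < ω₁) (hω₂ : 0 < ω₂) (hN : 0 < N) (p q : Cyl ω₁ ω₂ N)
    (h : bmap ω₁ ω₂ N p = bmap ω₁ ω₂ N q) : orbitRel ω₁ ω₂ N p q := by
  obtain ⟨a, b, t, ht⟩ := p
  obtain ⟨a', b', t', ht'⟩ := q
  have e1 := congrArg (fun x : EuclideanSpace ℝ (Fin 3) => x 0) h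
  have e2 := congrArg (fun x : EuclideanSpace ℝ (Fin 3) => x 1) h
  have e3 := congrArg (fun x : EuclideanSpace ℝ (Fin 3) => x 2) h
  obtain ⟨hc, hsC, hSt⟩ := core_inj _ _ _ _ _ _ _ _ _ _ (cCS a) (cCS b) (cCS a') (cCS b') e1 e2 e3
  have key : ∀ b : AddCircle ω₂, cS a * cC b = cS a' * cC b' → cS b = cS b' →
      (a' = a ∧ b' = b) ∨ (a' = -a ∧ b' = ((ω₂ / 2 : ℝ) : AddCircle ω₂) - b) := by
    intro b hsC hS
    have hs2 : cS a ^ 2 = cS a' ^ 2 := by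
      have h1 := cCS a; have h2 := cCS a'; rw [hc] at h1; linarith
    have hC2 : cC b ^ 2 = cC b' ^ 2 := by
      have h1 := cCS b; have h2 := cCS b'; rw [hS] at h1; linarith
    have : (cS a' = cS a ∧ cC b' = cC b) ∨ (cS a' = -cS a ∧ cC b' = -cC b) := by
      rcases sq_eq_sq_iff_eq_or_eq_neg.1 hs2 with h1 | h1 <;>
      rcases sq_eq_sq_iff_eq_or_eq_neg.1 hC2 with h2 | h2 <;>
      rw [h1, h2] at hsC ⊢
      · simp
      · have : cS a' = 0 ∨ cC b' = 0 := mul_eq_zero.1 (by linarith)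
        rcases this with h | h <;> simp [h]
      · have : cS a' = 0 ∨ cC b' = 0 := mul_eq_zero.1 (by linarith)
        rcases this with h | h <;> simp [h]
      · simp
    rcases this with ⟨h1, h2⟩ | ⟨h1, h2⟩
    · exact Or.inl ⟨cCS_ext hω₁.ne' hc.symm h1, cCS_ext hω₂.ne' h2 hS.symm⟩
    · exact Or.inr ⟨cCS_ext hω₁.ne' (by rw [cC_neg, hc]) (by rw [cS_neg, h1]),
        cCS_ext hω₂.ne' (by rw [cC_half hω₂.ne', h2]) (by rw [cS_half hω₂.ne', hS])⟩
  rcases hSt with ⟨hS, htt⟩ | ⟨hS, htt⟩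
  · have htt : t = t' := (div_left_inj' hN.ne').1 htt
    subst htt
    rcases key b hsC hS with ⟨rfl, rfl⟩ | ⟨rfl, rfl⟩
    · exact Or.inl rfl
    · exact Or.inr (Or.inl rfl)
  · have htt : t' = -t := by
      have h1 : t / N = (-t') / N := by rw [neg_div]; exact htt
      have := (div_left_inj' hN.ne').1 h1
      linarith
    subst htt
    rcases key (-b) (by rw [cC_neg]; exact hsC) (by rw [cS_neg, hS, neg_neg]) with
      ⟨rfl, rfl⟩ | ⟨rfl, rfl⟩
    · exact Or.inr (Or.inr (Or.inl rfl))
    · exact Or.inr (Or.inr (Or.inr rfl))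

lemma bmap_surj (ω₁ ω₂ N : ℝ) (hω₁ : 0 < ω₁) (hω₂ : 0 < ω₂) (hN : 0 < N)
    (x : EuclideanSpace ℝ (Fin 3))
    (hx : x ∈ Metric.closedBall (0 : EuclideanSpace ℝ (Fin 3)) 1) :
    ∃ p, bmap ω₁ ω₂ N p = x := by
  rw [mem_ball_iff] at hx
  obtain ⟨u, v, z, t, huvz, ht, e1, e2, e3⟩ := core_surj1 _ _ _ hx
  obtain ⟨c, s, C, S, h1, h2, f1, f2, f3⟩ := core_surj2 u v z huvz
  obtain ⟨a, rfl, rfl⟩ := cCS_surj hω₁.ne' c s h1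
  obtain ⟨b, rfl, rfl⟩ := cCS_surj hω₂.ne' C S h2
  have ht' := abs_le.1 ((sq_le_one_iff_abs_le_one t).1 ht)
  refine ⟨(a, b, ⟨N * t, by constructor <;> nlinarith⟩), ?_⟩
  have hNt : N * t / N = t := by field_simp
  ext i
  fin_cases i
  · simp [bmap, hNt, f1, e1]
  · simp [bmap, hNt, f2, e2]
  · simp [bmap, hNt, f3, e3]

/-- the quotient of the cylinder by the group generated by `σ₁, σ₂`,
with the quotient topology, is homeomorphic to the closed unit ball in `ℝ³`. -/
theorem stmt_1 (ω₁ ω₂ N : ℝ) (hω₁ : 0 < ω₁) (hω₂ : 0 < ω₂) (hN : 0 < N) :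
    Nonempty (Quot (orbitRel ω₁ ω₂ N) ≃ₜ
      (Metric.closedBall (0 : EuclideanSpace ℝ (Fin 3)) 1)) := by
  have : Fact (0 < ω₁) := ⟨hω₁⟩
  have : Fact (0 < ω₂) := ⟨hω₂⟩
  let F : Quot (orbitRel ω₁ ω₂ N) → Metric.closedBall (0 : EuclideanSpace ℝ (Fin 3)) 1 :=
    Quot.lift (fun p => ⟨bmap ω₁ ω₂ N p, bmap_mem ω₁ ω₂ N hN p⟩)
      (fun p q h => Subtype.ext (bmap_rel ω₁ ω₂ N hω₂ p q h))
  have hF : Continuous F :=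
    continuous_quot_lift _
      ((bmap_continuous ω₁ ω₂ N).subtype_mk _)
  have hb : Function.Bijective F := by
    constructor
    · rintro ⟨p⟩ ⟨q⟩ h
      exact Quot.sound (bmap_inj ω₁ ω₂ N hω₁ hω₂ hN p q (congrArg Subtype.val h))
    · rintro ⟨x, hx⟩
      obtain ⟨p, hp⟩ := bmap_surj ω₁ ω₂ N hω₁ hω₂ hN x hx
      exact ⟨Quot.mk _ p, Subtype.ext hp⟩
  have : CompactSpace (Quot (orbitRel ω₁ ω₂ N)) := Quot.compactSpace
  exact ⟨Continuous.homeoOfEquivCompactToT2 (f := Equiv.ofBijective F hb) hF⟩
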